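/- Let n ≥ 2, let M be a Garside monoid with Garside element h, and let H be the group of fractions of M (so M is a submonoid of H and every element of H equals a⁻¹b for some a, b ∈ M). Let ρ : Bₙ → Aut(G) be the Artin type representation associated to (H,h), where G = H₁ ∗ ⋯ ∗ Hₙ, let G̃ = G ⋊_ρ Bₙ, and let M̃ be the submonoid of G̃ generated by φ₁(M) together with the elements σ₁, …, σ_{n−1}. Then G̃ is the group of fractions of M̃: every element of G̃ can be written as a⁻¹b for some a, b ∈ M̃. -/

import Mathlib

def braidRels (m : ℕ) : Set (FreeGroup (Fin m)) :=
  { r | (∃ i j : Fin m, (i : ℕ) + 1 = (j : ℕ) ∧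
          r = FreeGroup.of i * FreeGroup.of j * FreeGroup.of i *
              (FreeGroup.of j * FreeGroup.of i * FreeGroup.of j)⁻¹) ∨
        (∃ i j : Fin m, (i : ℕ) + 2 ≤ (j : ℕ) ∧
          r = FreeGroup.of i * FreeGroup.of j * (FreeGroup.of j * FreeGroup.of i)⁻¹) }

abbrev BraidGroup (m : ℕ) : Type := PresentedGroup (braidRels m)

def braidGen {m : ℕ} (i : Fin m) : BraidGroup m := PresentedGroup.of i

def idx0 {n : ℕ} (k : Fin (n - 1)) : Fin n := ⟨k.1, by have := k.2; omega⟩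
def idx1 {n : ℕ} (k : Fin (n - 1)) : Fin n := ⟨k.1 + 1, by have := k.2; omega⟩

def IsArtinRep {n : ℕ} {H : Type} [Group H] (h : H)
    (ρ : BraidGroup (n - 1) →* MulAut (Monoid.CoprodI (fun _ : Fin n => H))) : Prop :=
  ∀ k : Fin (n - 1),
    (∀ y : H, ρ (braidGen k) (Monoid.CoprodI.of (i := idx0 k) y) =
        (Monoid.CoprodI.of (i := idx0 k) h)⁻¹ * Monoid.CoprodI.of (i := idx1 k) y *
          Monoid.CoprodI.of (i := idx0 k) h) ∧
    (∀ y : H, ρ (braidGen k) (Monoid.CoprodI.of (i := idx1 k) y) =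
        Monoid.CoprodI.of (i := idx0 k) h * Monoid.CoprodI.of (i := idx0 k) y *
          (Monoid.CoprodI.of (i := idx0 k) h)⁻¹) ∧
    (∀ j : Fin n, j ≠ idx0 k → j ≠ idx1 k →
      ∀ y : H, ρ (braidGen k) (Monoid.CoprodI.of (i := j) y) = Monoid.CoprodI.of (i := j) y)

/-- Left divisibility in a monoid: `a ≤_L b`. -/
def leftDvd {M : Type*} [Monoid M] (a b : M) : Prop := ∃ c, a * c = b

/-- Right divisibility in a monoid: `a ≤_R b`. -/
def rightDvd {M : Type*} [Monoid M] (a b : M) : Prop := ∃ c, c * a = b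

/-- A monoid is atomic if it admits a norm `ν : M → ℕ`. -/
def IsAtomicMonoid (M : Type*) [Monoid M] : Prop :=
  ∃ ν : M → ℕ, (∀ a, ν a = 0 ↔ a = 1) ∧ ∀ a b, ν a + ν b ≤ ν (a * b)

/-- `M` is a Garside monoid with Garside element `Δ`: finitely generated, atomic,
left and right cancellative, the left and right divisibility orders are lattices
(partial orders with binary joins and meets), the left divisors of `Δ` generate `M`,
and the left and right divisors of `Δ` coincide. -/
def IsGarside (M : Type*) [Monoid M] (Δ : M) : Prop :=
  (∃ T : Finset M, Submonoid.closure (T : Set M) = ⊤) ∧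
  IsAtomicMonoid M ∧
  (∀ a b c : M, a * b = a * c → b = c) ∧
  (∀ a b c : M, b * a = c * a → b = c) ∧
  (∀ a b : M, leftDvd a b → leftDvd b a → a = b) ∧
  (∀ a b : M, rightDvd a b → rightDvd b a → a = b) ∧
  (∀ a b : M, ∃ j, leftDvd a j ∧ leftDvd b j ∧ ∀ z, leftDvd a z → leftDvd b z → leftDvd j z) ∧
  (∀ a b : M, ∃ m, leftDvd m a ∧ leftDvd m b ∧ ∀ z, leftDvd z a → leftDvd z b → leftDvd z m) ∧
  (∀ a b : M, ∃ j, rightDvd a j ∧ rightDvd b j ∧ ∀ z, rightDvd a z → rightDvd b z → rightDvd j z) ∧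
  (∀ a b : M, ∃ m, rightDvd m a ∧ rightDvd m b ∧ ∀ z, rightDvd z a → rightDvd z b → rightDvd z m) ∧
  Submonoid.closure {x : M | leftDvd x Δ} = ⊤ ∧
  {x : M | leftDvd x Δ} = {x : M | rightDvd x Δ}

/-- The submonoid `M̃` of `G̃ = G ⋊_ρ Bₙ` generated by `φ₁(M)` and the positive braids. -/
def tildeM (n : ℕ) (hn : 2 ≤ n) {H : Type} [Group H] (M : Submonoid H)
    (ρ : BraidGroup (n - 1) →* MulAut (Monoid.CoprodI (fun _ : Fin n => H))) :
    Submonoid (Monoid.CoprodI (fun _ : Fin n => H) ⋊[ρ] BraidGroup (n - 1)) :=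
  Submonoid.closure
    (Set.range (fun m : M =>
        SemidirectProduct.inl (Monoid.CoprodI.of (i := (⟨0, by omega⟩ : Fin n)) (m : H))) ∪
     Set.range (fun i : Fin (n - 1) => SemidirectProduct.inr (braidGen i)))

/-- The element `Δ = (h₁ σ₁ σ₂ ⋯ σ_{n-1})ⁿ` of `G̃ = G ⋊_ρ Bₙ`. -/
def tildeDelta (n : ℕ) (hn : 2 ≤ n) {H : Type} [Group H] (h : H)
    (ρ : BraidGroup (n - 1) →* MulAut (Monoid.CoprodI (fun _ : Fin n => H))) :
    Monoid.CoprodI (fun _ : Fin n => H) ⋊[ρ] BraidGroup (n - 1) :=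
  (SemidirectProduct.inl (Monoid.CoprodI.of (i := (⟨0, by omega⟩ : Fin n)) h) *
    (List.ofFn (fun i : Fin (n - 1) =>
      (SemidirectProduct.inr (braidGen i) :
        Monoid.CoprodI (fun _ : Fin n => H) ⋊[ρ] BraidGroup (n - 1)))).prod) ^ n

section Fractions

variable {Γ : Type*} [Group Γ]

/-- If `D ∈ N` satisfies `D N D⁻¹ ⊆ N`, these are the elements of the form `D ^ (-k) * b`
with `b ∈ N`. -/
def fractionSubmonoid (N : Submonoid Γ) (D : Γ) (hconj : ∀ x ∈ N, D * x * D⁻¹ ∈ N) :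
    Submonoid Γ where
  carrier := {g | ∃ k : ℕ, D ^ k * g ∈ N}
  one_mem' := ⟨0, by simp⟩
  mul_mem' := by
    have hpow : ∀ (l : ℕ), ∀ x ∈ N, D ^ l * x * (D ^ l)⁻¹ ∈ N := by
      intro l
      induction l with
      | zero => intro x hx; simpa using hx
      | succ l ih =>
        intro x hx
        have h := ih _ (hconj x hx)
        rw [pow_succ]
        convert h using 1
        group
    rintro g g' ⟨k, hk⟩ ⟨l, hl⟩
    refine ⟨l + k, ?_⟩
    convert N.mul_mem (hpow l _ hk) hl using 1
    rw [pow_add]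
    group

theorem le_fractionSubmonoid (N : Submonoid Γ) (D : Γ) (hconj : ∀ x ∈ N, D * x * D⁻¹ ∈ N) :
    N ≤ fractionSubmonoid N D hconj :=
  fun x hx => ⟨0, by simpa using hx⟩

/-- The group of units of a submonoid of a group. -/
def Submonoid.unitSubgroup (S : Submonoid Γ) : Subgroup Γ where
  carrier := {g | g ∈ S ∧ g⁻¹ ∈ S}
  one_mem' := ⟨S.one_mem, by simp⟩
  mul_mem' := fun ha hb => ⟨S.mul_mem ha.1 hb.1, by
    rw [mul_inv_rev]; exact S.mul_mem hb.2 ha.2⟩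
  inv_mem' := fun ha => ⟨ha.2, by simpa using ha.1⟩

theorem Submonoid.mem_unitSubgroup_of_mul {S : Submonoid Γ} {a b : Γ} (ha : a ∈ S) (hb : b ∈ S)
    (hab : a * b ∈ S.unitSubgroup) : a ∈ S.unitSubgroup ∧ b ∈ S.unitSubgroup := by
  refine ⟨⟨ha, ?_⟩, ⟨hb, ?_⟩⟩
  · simpa using S.mul_mem hb hab.2
  · simpa using S.mul_mem hab.2 ha

end Fractions

section JucysMurphy

variable {Γ : Type*} [Group Γ]

/-- The multiplicative Jucys–Murphy elements `s_{k-1} ⋯ s₀ h s₀ ⋯ s_{k-1}`. -/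
def jucysMurphy (h : Γ) (s : ℕ → Γ) : ℕ → Γ
  | 0 => h
  | k + 1 => s k * jucysMurphy h s k * s k

/-- The product of the first `k` Jucys–Murphy elements. -/
def jucysMurphyProd (h : Γ) (s : ℕ → Γ) : ℕ → Γ
  | 0 => 1
  | k + 1 => jucysMurphyProd h s k * jucysMurphy h s k

variable {h : Γ} {s : ℕ → Γ} {m : ℕ}

theorem commute_jucysMurphy_of_lt (hcomm : ∀ i j, i + 2 ≤ j → j < m → Commute (s i) (s j))
    (hh : ∀ i, 1 ≤ i → i < m → Commute (s i) h) {j : ℕ} (hj : j < m) :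
    ∀ k, k < j → Commute (s j) (jucysMurphy h s k)
  | 0, hk => hh j hk hj
  | k + 1, hk =>
    have hs : Commute (s j) (s k) := (hcomm k j (by omega) hj).symm
    (hs.mul_right (commute_jucysMurphy_of_lt hcomm hh hj k (by omega))).mul_right hs

theorem commute_jucysMurphy_of_gt (hcomm : ∀ i j, i + 2 ≤ j → j < m → Commute (s i) (s j))
    (hbraid : ∀ i, i + 1 < m → s i * s (i + 1) * s i = s (i + 1) * s i * s (i + 1))
    (hh : ∀ i, 1 ≤ i → i < m → Commute (s i) h) {i k : ℕ} (hk : i + 2 ≤ k) (hkm : k ≤ m) :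
    Commute (s i) (jucysMurphy h s k) := by
  induction k, hk using Nat.le_induction with
  | base =>
    have hb := hbraid i (by omega)
    have hX : s (i + 1) * jucysMurphy h s i = jucysMurphy h s i * s (i + 1) :=
      commute_jucysMurphy_of_lt hcomm hh (by omega) i (by omega)
    simp only [jucysMurphy]
    generalize jucysMurphy h s i = X at hX
    generalize s i = a at *
    generalize s (i + 1) = b at *
    calc a * (b * (a * X * a) * b) = (a * b * a) * X * a * b := by group
      _ = b * a * (b * X) * a * b := by rw [hb]; group
      _ = b * a * X * (b * a * b) := by rw [hX]; group
      _ = b * (a * X * a) * b * a := by rw [← hb]; group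
  | succ k hk ih =>
    have hs := hcomm i k hk (by omega)
    exact (hs.mul_right (ih (by omega))).mul_right hs

theorem commute_jucysMurphy_succ (hcomm : ∀ i j, i + 2 ≤ j → j < m → Commute (s i) (s j))
    (hbraid : ∀ i, i + 1 < m → s i * s (i + 1) * s i = s (i + 1) * s i * s (i + 1))
    (hh : ∀ i, 1 ≤ i → i < m → Commute (s i) h) (h0 : Commute h (s 0 * h * s 0)) :
    ∀ k, k < m → Commute (jucysMurphy h s k) (jucysMurphy h s (k + 1))
  | 0, _ => h0
  | k + 1, hk => by
    have hs : Commute (s k) (jucysMurphy h s (k + 2)) :=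
      commute_jucysMurphy_of_gt hcomm hbraid hh le_rfl (by omega)
    have hs' : Commute (jucysMurphy h s k) (s (k + 1)) :=
      (commute_jucysMurphy_of_lt hcomm hh hk k (by omega)).symm
    have hX : Commute (jucysMurphy h s k) (jucysMurphy h s (k + 2)) :=
      (hs'.mul_right (commute_jucysMurphy_succ hcomm hbraid hh h0 k (by omega))).mul_right hs'
    exact (hs.mul_left hX).mul_left hs

theorem commute_jucysMurphyProd_of_le (hcomm : ∀ i j, i + 2 ≤ j → j < m → Commute (s i) (s j))
    (hh : ∀ i, 1 ≤ i → i < m → Commute (s i) h) {i : ℕ} (hi : i < m) :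
    ∀ k, k ≤ i → Commute (s i) (jucysMurphyProd h s k)
  | 0, _ => Commute.one_right _
  | k + 1, hk => (commute_jucysMurphyProd_of_le hcomm hh hi k (by omega)).mul_right
      (commute_jucysMurphy_of_lt hcomm hh hi k hk)

theorem commute_jucysMurphyProd (hcomm : ∀ i j, i + 2 ≤ j → j < m → Commute (s i) (s j))
    (hbraid : ∀ i, i + 1 < m → s i * s (i + 1) * s i = s (i + 1) * s i * s (i + 1))
    (hh : ∀ i, 1 ≤ i → i < m → Commute (s i) h) (h0 : Commute h (s 0 * h * s 0))
    {i k : ℕ} (hk : i + 2 ≤ k) (hkm : k ≤ m + 1) :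
    Commute (s i) (jucysMurphyProd h s k) := by
  induction k, hk using Nat.le_induction with
  | base =>
    have hX : jucysMurphy h s i * (s i * jucysMurphy h s i * s i) =
        s i * jucysMurphy h s i * s i * jucysMurphy h s i :=
      commute_jucysMurphy_succ hcomm hbraid hh h0 i (by omega)
    have hp := commute_jucysMurphyProd_of_le hcomm hh (show i < m by omega) i le_rfl
    have hXX : Commute (s i) (jucysMurphy h s i * jucysMurphy h s (i + 1)) := by
      change s i * (jucysMurphy h s i * (s i * jucysMurphy h s i * s i)) =
        jucysMurphy h s i * (s i * jucysMurphy h s i * s i) * s i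
      conv_rhs => rw [hX]
      group
    have := hp.mul_right hXX
    rwa [← mul_assoc] at this
  | succ k hk ih =>
    exact (ih (by omega)).mul_right (commute_jucysMurphy_of_gt hcomm hbraid hh hk (by omega))

theorem jucysMurphy_mul_eq {y z : Γ} (hy : ∀ i, 1 ≤ i → i < m → Commute (s i) y)
    (hz : ∀ i, 1 ≤ i → i < m → Commute (s i) z)
    (hyz : h * y = z * h) (hyz' : s 0 * h * s 0 * y = z * (s 0 * h * s 0)) :
    ∀ k, k ≤ m → jucysMurphy h s k * y = z * jucysMurphy h s k
  | 0, _ => hyz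
  | 1, _ => hyz'
  | k + 2, hk => by
    have ih := jucysMurphy_mul_eq hy hz hyz hyz' (k + 1) (by omega)
    have h1 : s (k + 1) * y = y * s (k + 1) := hy (k + 1) (by omega) (by omega)
    have h2 : s (k + 1) * z = z * s (k + 1) := hz (k + 1) (by omega) (by omega)
    change s (k + 1) * jucysMurphy h s (k + 1) * s (k + 1) * y =
      z * (s (k + 1) * jucysMurphy h s (k + 1) * s (k + 1))
    rw [mul_assoc, h1, ← mul_assoc, mul_assoc (s (k + 1)), ih, ← mul_assoc, h2]
    group

theorem jucysMurphyProd_conj_mem {Y : Set Γ} (hY : ∀ y ∈ Y, ∀ i, 1 ≤ i → i < m → Commute (s i) y)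
    (hconj : ∀ y ∈ Y, ∃ z ∈ Y, h * y = z * h ∧ s 0 * h * s 0 * y = z * (s 0 * h * s 0)) :
    ∀ k, k ≤ m + 1 → ∀ y ∈ Y, jucysMurphyProd h s k * y * (jucysMurphyProd h s k)⁻¹ ∈ Y
  | 0, _, y, hy => by simpa [jucysMurphyProd] using hy
  | k + 1, hk, y, hy => by
    obtain ⟨z, hz, h1, h2⟩ := hconj y hy
    have ih := jucysMurphyProd_conj_mem hY hconj k (by omega) z hz
    have hX := jucysMurphy_mul_eq (hY y hy) (hY z hz) h1 h2 k (by omega)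
    convert ih using 1
    simp only [jucysMurphyProd]
    rw [mul_assoc _ _ y, hX]
    group

theorem jucysMurphy_mem {N : Submonoid Γ} (hN : h ∈ N) (hs : ∀ i, i < m → s i ∈ N) :
    ∀ k, k ≤ m → jucysMurphy h s k ∈ N
  | 0, _ => hN
  | k + 1, hk => N.mul_mem (N.mul_mem (hs k hk) (jucysMurphy_mem hN hs k (by omega))) (hs k hk)

theorem jucysMurphyProd_mem {N : Submonoid Γ} (hN : h ∈ N) (hs : ∀ i, i < m → s i ∈ N) :
    ∀ k, k ≤ m + 1 → jucysMurphyProd h s k ∈ N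
  | 0, _ => N.one_mem
  | k + 1, hk => N.mul_mem (jucysMurphyProd_mem hN hs k (by omega))
      (jucysMurphy_mem hN hs k (by omega))

theorem jucysMurphy_mem_unitSubgroup {S : Submonoid Γ} (hS : h ∈ S) (hs : ∀ i, i < m → s i ∈ S) :
    ∀ k, k ≤ m + 1 → jucysMurphyProd h s k ∈ S.unitSubgroup →
      ∀ i, i < k → jucysMurphy h s i ∈ S.unitSubgroup
  | k + 1, hk, hP, i, hi => by
    obtain ⟨h1, h2⟩ := Submonoid.mem_unitSubgroup_of_mul
      (jucysMurphyProd_mem hS hs k (by omega)) (jucysMurphy_mem hS hs k (by omega)) hP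
    obtain rfl | hik := eq_or_ne i k
    · exact h2
    · exact jucysMurphy_mem_unitSubgroup hS hs k (by omega) h1 i (by omega)

/-- Let `N` be generated by `Y ∪ {s i | i < m}`, where `h ∈ Y` and the type B braid relations
hold up to an automorphism of `Y`. Then `N` lies in a submonoid of left fractions of `N` in which
`h` and all the `s i` are invertible. -/
theorem exists_unit_fractions {Y : Set Γ} (hhY : h ∈ Y)
    (hcomm : ∀ i j, i + 2 ≤ j → j < m → Commute (s i) (s j))
    (hbraid : ∀ i, i + 1 < m → s i * s (i + 1) * s i = s (i + 1) * s i * s (i + 1))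
    (hY : ∀ y ∈ Y, ∀ i, 1 ≤ i → i < m → Commute (s i) y)
    (h0 : Commute h (s 0 * h * s 0))
    (hconj : ∀ y ∈ Y, ∃ z ∈ Y, h * y = z * h ∧ s 0 * h * s 0 * y = z * (s 0 * h * s 0))
    {N : Submonoid Γ} (hN : N = Submonoid.closure (Y ∪ {g | ∃ i, i < m ∧ s i = g})) :
    ∃ S : Submonoid Γ, N ≤ S ∧ (∀ g ∈ S, ∃ a ∈ N, ∃ b ∈ N, g = a⁻¹ * b) ∧
      h ∈ S.unitSubgroup ∧ ∀ i, i < m → s i ∈ S.unitSubgroup := by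
  have hYN : ∀ y ∈ Y, y ∈ N := fun y hy => hN ▸ Submonoid.subset_closure (Or.inl hy)
  have hsN : ∀ i, i < m → s i ∈ N := fun i hi =>
    hN ▸ Submonoid.subset_closure (Or.inr ⟨i, hi, rfl⟩)
  set D := jucysMurphyProd h s (m + 1) with hD
  have hDN : D ∈ N := jucysMurphyProd_mem (hYN h hhY) hsN _ le_rfl
  have hDconj : ∀ x ∈ N, D * x * D⁻¹ ∈ N := by
    intro x hx
    have hle : N ≤ N.comap (MulAut.conj D).toMonoidHom := by
      conv_lhs => rw [hN]
      rw [Submonoid.closure_le]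
      rintro _ (hy | ⟨i, hi, rfl⟩)
      · exact hYN _ (jucysMurphyProd_conj_mem hY hconj (m + 1) le_rfl _ hy)
      · have hc : Commute (s i) D :=
          commute_jucysMurphyProd hcomm hbraid (hY h hhY) h0 (by omega) le_rfl
        change D * s i * D⁻¹ ∈ N
        rw [← hc.eq, mul_inv_cancel_right]
        exact hsN i hi
    exact hle hx
  have hNS := le_fractionSubmonoid N D hDconj
  have hDU : D ∈ (fractionSubmonoid N D hDconj).unitSubgroup :=
    ⟨hNS hDN, 1, by simp⟩
  have hXU := jucysMurphy_mem_unitSubgroup (hNS (hYN h hhY)) (fun i hi => hNS (hsN i hi))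
    (m + 1) le_rfl hDU
  refine ⟨fractionSubmonoid N D hDconj, hNS, ?_, hXU 0 (by omega), fun i hi => ?_⟩
  · rintro g ⟨k, hk⟩
    exact ⟨D ^ k, N.pow_mem hDN k, _, hk, by group⟩
  · exact (Submonoid.mem_unitSubgroup_of_mul
      (hNS (N.mul_mem (hsN i hi) (jucysMurphy_mem (hYN h hhY) hsN i hi.le)))
      (hNS (hsN i hi)) (hXU (i + 1) (by omega))).2

end JucysMurphy

theorem braidGen_comm {m : ℕ} {i j : Fin m} (hij : (i : ℕ) + 2 ≤ j) :
    braidGen i * braidGen j = braidGen j * braidGen i := by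
  rw [← mul_inv_eq_one]
  exact PresentedGroup.one_of_mem (rels := braidRels m) (Or.inr ⟨i, j, hij, rfl⟩)

theorem braidGen_braid {m : ℕ} {i j : Fin m} (hij : (i : ℕ) + 1 = j) :
    braidGen i * braidGen j * braidGen i = braidGen j * braidGen i * braidGen j := by
  rw [← mul_inv_eq_one]
  exact PresentedGroup.one_of_mem (rels := braidRels m) (Or.inl ⟨i, j, hij, rfl⟩)

namespace IsGarside

variable {M : Type*} [Monoid M] {Δ : M}

theorem exists_mul_eq_mul (hM : IsGarside M Δ) (x : M) : ∃ z, Δ * x = z * Δ := by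
  obtain ⟨-, -, -, -, -, -, -, -, -, -, hgen, hLR⟩ := hM
  have hx : x ∈ Submonoid.closure {x : M | leftDvd x Δ} := hgen ▸ Submonoid.mem_top x
  induction hx using Submonoid.closure_induction with
  | mem x hx =>
    have hx' : x ∈ {x : M | rightDvd x Δ} := hLR ▸ hx
    obtain ⟨z, hz⟩ := hx'
    have hz' : z ∈ {x : M | rightDvd x Δ} := hLR ▸ (⟨x, hz⟩ : leftDvd z Δ)
    obtain ⟨w, hw⟩ := hz'
    exact ⟨w, by rw [← hz, ← mul_assoc w, hw, hz]⟩
  | one => exact ⟨1, by simp⟩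
  | mul x y _ _ hx hy =>
    obtain ⟨a, ha⟩ := hx
    obtain ⟨b, hb⟩ := hy
    exact ⟨a * b, by rw [← mul_assoc, ha, mul_assoc, hb, mul_assoc]⟩

theorem map_mem_unitSubgroup {Γ : Type*} [Group Γ] (hM : IsGarside M Δ) (f : M →* Γ)
    {S : Submonoid Γ} (hf : ∀ x, f x ∈ S) (hΔ : f Δ ∈ S.unitSubgroup) (x : M) :
    f x ∈ S.unitSubgroup := by
  have hgen := hM.2.2.2.2.2.2.2.2.2.2.1
  have hx : x ∈ Submonoid.closure {x : M | leftDvd x Δ} := hgen ▸ Submonoid.mem_top x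
  induction hx using Submonoid.closure_induction with
  | mem x hx =>
    obtain ⟨c, rfl⟩ := hx
    rw [map_mul] at hΔ
    exact (Submonoid.mem_unitSubgroup_of_mul (hf x) (hf c) hΔ).1
  | one => simp [one_mem]
  | mul x y _ _ hx hy => rw [map_mul]; exact mul_mem hx hy

end IsGarside

namespace IsArtinRep

variable {n : ℕ} {H : Type} [Group H] {h : H}
  {ρ : BraidGroup (n - 1) →* MulAut (Monoid.CoprodI (fun _ : Fin n => H))}

/-- The `i`-th copy of `H` inside `G ⋊ Bₙ`. -/
def copy (ρ : BraidGroup (n - 1) →* MulAut (Monoid.CoprodI (fun _ : Fin n => H))) (i : Fin n) :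
    H →* Monoid.CoprodI (fun _ : Fin n => H) ⋊[ρ] BraidGroup (n - 1) :=
  SemidirectProduct.inl.comp (Monoid.CoprodI.of (M := fun _ : Fin n => H) (i := i))

/-- The `k`-th standard braid inside `G ⋊ Bₙ`. -/
def braid (ρ : BraidGroup (n - 1) →* MulAut (Monoid.CoprodI (fun _ : Fin n => H)))
    (k : Fin (n - 1)) : Monoid.CoprodI (fun _ : Fin n => H) ⋊[ρ] BraidGroup (n - 1) :=
  SemidirectProduct.inr (braidGen k)

theorem braid_mul_copy_idx0 (hρ : IsArtinRep h ρ) (k : Fin (n - 1)) (y : H) :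
    braid ρ k * copy ρ (idx0 k) y * (braid ρ k)⁻¹ =
      (copy ρ (idx0 k) h)⁻¹ * copy ρ (idx1 k) y * copy ρ (idx0 k) h := by
  have := congrArg (SemidirectProduct.inl (φ := ρ)) ((hρ k).1 y)
  rw [SemidirectProduct.inl_aut] at this
  simpa [copy, braid] using this

theorem braid_mul_copy_idx1 (hρ : IsArtinRep h ρ) (k : Fin (n - 1)) (y : H) :
    braid ρ k * copy ρ (idx1 k) y * (braid ρ k)⁻¹ =
      copy ρ (idx0 k) h * copy ρ (idx0 k) y * (copy ρ (idx0 k) h)⁻¹ := by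
  have := congrArg (SemidirectProduct.inl (φ := ρ)) ((hρ k).2.1 y)
  rw [SemidirectProduct.inl_aut] at this
  simpa [copy, braid] using this

theorem commute_braid_copy (hρ : IsArtinRep h ρ) (k : Fin (n - 1)) {j : Fin n} (h0 : j ≠ idx0 k)
    (h1 : j ≠ idx1 k) (y : H) : Commute (braid ρ k) (copy ρ j y) := by
  have := congrArg (SemidirectProduct.inl (φ := ρ)) ((hρ k).2.2 j h0 h1 y)
  rw [SemidirectProduct.inl_aut] at this
  exact mul_inv_eq_iff_eq_mul.mp (by simpa [copy, braid] using this)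

theorem copy_idx1 (hρ : IsArtinRep h ρ) (k : Fin (n - 1)) (y : H) :
    copy ρ (idx1 k) y = copy ρ (idx0 k) h * (braid ρ k * copy ρ (idx0 k) y * (braid ρ k)⁻¹) *
      (copy ρ (idx0 k) h)⁻¹ := by
  rw [hρ.braid_mul_copy_idx0]
  group

theorem braid_copy_braid_mul (hρ : IsArtinRep h ρ) (k : Fin (n - 1)) {y z : H}
    (hyz : h * y = z * h) :
    braid ρ k * copy ρ (idx0 k) h * braid ρ k * copy ρ (idx0 k) y =
      copy ρ (idx0 k) z * (braid ρ k * copy ρ (idx0 k) h * braid ρ k) := by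
  have hz : z = h * y * h⁻¹ := by rw [hyz, mul_inv_cancel_right]
  have h1 := hρ.braid_mul_copy_idx1 k y
  rw [hρ.copy_idx1, ← map_inv, ← map_mul, ← map_mul, ← hz] at h1
  rw [← h1, map_inv]
  group

/-- A subgroup containing the first copy of `H` and the standard braids is everything. -/
theorem eq_top_of_mem (hρ : IsArtinRep h ρ) (hn : 0 < n)
    {U : Subgroup (Monoid.CoprodI (fun _ : Fin n => H) ⋊[ρ] BraidGroup (n - 1))}
    (hcopy : ∀ y, copy ρ ⟨0, hn⟩ y ∈ U) (hbraid : ∀ k, braid ρ k ∈ U)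
    (g : Monoid.CoprodI (fun _ : Fin n => H) ⋊[ρ] BraidGroup (n - 1)) : g ∈ U := by
  have hall : ∀ (i : ℕ) (hi : i < n) (y : H), copy ρ ⟨i, hi⟩ y ∈ U := by
    intro i
    induction i with
    | zero => intro _; exact hcopy
    | succ i ih =>
      intro hi y
      have hc := hρ.copy_idx1 ⟨i, by omega⟩ y
      have ih' := ih (by omega)
      change copy ρ (idx1 (⟨i, by omega⟩ : Fin (n - 1))) y ∈ U
      rw [hc]
      exact mul_mem (mul_mem (ih' h) (mul_mem (mul_mem (hbraid _) (ih' y)) (inv_mem (hbraid _))))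
        (inv_mem (ih' h))
  have hl : ∀ x : Monoid.CoprodI (fun _ : Fin n => H), SemidirectProduct.inl x ∈ U := by
    intro x
    induction x using Monoid.CoprodI.induction_on with
    | one => simp [one_mem]
    | of i y => exact hall i i.2 y
    | mul x y hx hy => rw [map_mul]; exact mul_mem hx hy
  have hr : ∀ b : BraidGroup (n - 1), SemidirectProduct.inr b ∈ U := by
    intro b
    have hle : Subgroup.closure (Set.range (PresentedGroup.of (rels := braidRels (n - 1)))) ≤
        U.comap SemidirectProduct.inr := by
      rw [Subgroup.closure_le]
      rintro _ ⟨k, rfl⟩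
      exact hbraid k
    rw [PresentedGroup.closure_range_of] at hle
    exact hle (Subgroup.mem_top b)
  rw [← SemidirectProduct.inl_left_mul_inr_right g]
  exact mul_mem (hl _) (hr _)

end IsArtinRep

open IsArtinRep in
theorem semidirect_product_group_of_fractions (n : ℕ) (hn : 2 ≤ n)
    {H : Type} [Group H] (M : Submonoid H) (hGar : M)
    (hGarside : IsGarside M hGar)
    (hfrac : ∀ g : H, ∃ a b : M, g = (a : H)⁻¹ * (b : H))
    (ρ : BraidGroup (n - 1) →* MulAut (Monoid.CoprodI (fun _ : Fin n => H)))
    (hρ : IsArtinRep ((hGar : H)) ρ) :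
    ∀ g : Monoid.CoprodI (fun _ : Fin n => H) ⋊[ρ] BraidGroup (n - 1),
      ∃ a b : tildeM n hn M ρ, g = (a : Monoid.CoprodI (fun _ : Fin n => H) ⋊[ρ] BraidGroup (n - 1))⁻¹ * b := by
  let f : M →* Monoid.CoprodI (fun _ : Fin n => H) ⋊[ρ] BraidGroup (n - 1) :=
    (copy ρ ⟨0, by omega⟩).comp M.subtype
  let s : ℕ → Monoid.CoprodI (fun _ : Fin n => H) ⋊[ρ] BraidGroup (n - 1) :=
    fun i => if hi : i < n - 1 then braid ρ ⟨i, hi⟩ else 1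
  have hs : ∀ i (hi : i < n - 1), s i = braid ρ ⟨i, hi⟩ := fun i hi => dif_pos hi
  have hs0 := hs 0 (by omega)
  have hswap : ∀ x z : M, hGar * x = z * hGar → s 0 * f hGar * s 0 * f x =
      f z * (s 0 * f hGar * s 0) := fun x z hxz => by
    rw [hs0]
    exact hρ.braid_copy_braid_mul ⟨0, by omega⟩ (congrArg Subtype.val hxz)
  obtain ⟨S, hNS, hS, hh, hsU⟩ := exists_unit_fractions (h := f hGar) (s := s) (m := n - 1)
    (Y := Set.range f) ⟨hGar, rfl⟩
    (fun i j hij hj => by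
      rw [hs i (by omega), hs j hj]
      have := congrArg (SemidirectProduct.inr (φ := ρ))
        (braidGen_comm (i := (⟨i, by omega⟩ : Fin (n - 1))) (j := ⟨j, hj⟩) hij)
      rw [map_mul, map_mul] at this
      exact this)
    (fun i hi => by
      rw [hs i (by omega), hs (i + 1) hi]
      have := congrArg (SemidirectProduct.inr (φ := ρ))
        (braidGen_braid (i := (⟨i, by omega⟩ : Fin (n - 1))) (j := ⟨i + 1, hi⟩) rfl)
      simp only [map_mul] at this
      exact this)
    (by
      rintro _ ⟨x, rfl⟩ i hi him
      rw [hs i him]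
      refine hρ.commute_braid_copy _ ?_ ?_ _ <;> simp [idx0, idx1]; omega)
    (hswap hGar hGar rfl).symm
    (by
      rintro _ ⟨x, rfl⟩
      obtain ⟨z, hz⟩ := hGarside.exists_mul_eq_mul x
      exact ⟨f z, ⟨z, rfl⟩, by rw [← map_mul, hz, map_mul], hswap x z hz⟩)
    (N := tildeM n hn M ρ)
    (by
      refine congrArg Submonoid.closure (congrArg₂ _ rfl ?_)
      ext g
      constructor
      · rintro ⟨i, rfl⟩
        exact ⟨i, i.2, hs i i.2⟩
      · rintro ⟨i, hi, rfl⟩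
        exact ⟨⟨i, hi⟩, (hs i hi).symm⟩)
  intro g
  have hfN : ∀ x, f x ∈ tildeM n hn M ρ := fun x =>
    Submonoid.subset_closure (Or.inl ⟨x, rfl⟩)
  have hfU := hGarside.map_mem_unitSubgroup f (fun x => hNS (hfN x)) hh
  have hg : g ∈ S.unitSubgroup := by
    refine hρ.eq_top_of_mem (by omega) (fun y => ?_) (fun k => hs k k.2 ▸ hsU k k.2) g
    obtain ⟨a, b, rfl⟩ := hfrac y
    rw [map_mul, map_inv]
    exact mul_mem (inv_mem (hfU a)) (hfU b)
  obtain ⟨a, ha, b, hb, rfl⟩ := hS g hg.1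
  exact ⟨⟨a, ha⟩, ⟨b, hb⟩, rfl⟩
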